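/- The series ∑_{n=0}^∞ C(2n,n)² · (3/128)^n · [14n(196n² + 196n − 3)·P_{n−1}(1/2) − (1372n³ + 3024n² + 1631n + 375)·P_n(1/2)] converges to 400√2/π, where the term involving P_{n−1} is understood to vanish at n = 0 (its coefficient 14n·(196n² + 196n − 3) is 0 there). -/

import Mathlib

open Real Filter

/-- The Legendre polynomial of degree `n`, given by the explicit formula
`P_n(x) = 2^{-n} ∑_{j=0}^{n} C(n,j)^2 (x-1)^{n-j} (x+1)^j`. -/
noncomputable def legendreP (n : ℕ) (x : ℝ) : ℝ :=
  (2 : ℝ)⁻¹ ^ n *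
    ∑ j ∈ Finset.range (n + 1), (n.choose j : ℝ) ^ 2 * (x - 1) ^ (n - j) * (x + 1) ^ j

/-- Taylor coefficients of `(2/π) K` as a function of the parameter `m = k²`. -/
noncomputable def ellipticCoeff (n : ℕ) : ℝ := (n.centralBinom : ℝ) ^ 2 / 16 ^ n

lemma ellipticCoeff_zero : ellipticCoeff 0 = 1 := by simp [ellipticCoeff]

lemma ellipticCoeff_pos (n : ℕ) : 0 < ellipticCoeff n := by
  have := Nat.centralBinom_pos n
  unfold ellipticCoeff
  positivity

lemma ellipticCoeff_succ (n : ℕ) :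
    ((n : ℝ) + 1) ^ 2 * ellipticCoeff (n + 1) = (n + 1 / 2) ^ 2 * ellipticCoeff n := by
  have h : ((n : ℝ) + 1) * ((n + 1).centralBinom : ℝ) = 2 * (2 * n + 1) * n.centralBinom := by
    exact_mod_cast Nat.succ_mul_centralBinom_succ n
  unfold ellipticCoeff
  rw [mul_div_assoc', ← mul_pow, h]
  field_simp
  ring

lemma ellipticCoeff_le_one (n : ℕ) : ellipticCoeff n ≤ 1 := by
  have h : (n.centralBinom : ℝ) ≤ 4 ^ n := by
    have h := Nat.sum_range_choose (2 * n)
    have h2 : (2 * n).choose n ≤ ∑ m ∈ Finset.range (2 * n + 1), (2 * n).choose m :=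
      Finset.single_le_sum (f := fun m => (2 * n).choose m) (fun _ _ => Nat.zero_le _)
        (Finset.mem_range.2 (by omega))
    rw [h, pow_mul] at h2
    exact_mod_cast h2
  unfold ellipticCoeff
  rw [div_le_one (by positivity)]
  calc (n.centralBinom : ℝ) ^ 2 ≤ (4 ^ n) ^ 2 := by gcongr
    _ = 16 ^ n := by rw [← pow_mul, mul_comm, pow_mul]; norm_num

lemma tendsto_mul_ellipticCoeff :
    Tendsto (fun n : ℕ => ((n : ℝ) + 1) * ellipticCoeff (n + 1)) atTop (nhds (1 / π)) := by
  have hW : ∀ n : ℕ, ellipticCoeff n = (Wallis.W n)⁻¹ / (2 * n + 1) := by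
    intro n
    have h : ((2 * n).factorial : ℝ) = n.centralBinom * n.factorial ^ 2 := by
      have := Nat.choose_mul_factorial_mul_factorial (show n ≤ 2 * n by omega)
      rw [show 2 * n - n = n by omega] at this
      rw [← this, Nat.centralBinom]
      push_cast
      ring
    have hn : (n.factorial : ℝ) ≠ 0 := by positivity
    have hc : (n.centralBinom : ℝ) ≠ 0 := by exact_mod_cast Nat.centralBinom_ne_zero n
    rw [Wallis.W_eq_factorial_ratio, h, ellipticCoeff, pow_mul]
    field_simp
    norm_num
  have h1 : Tendsto (fun n : ℕ => (Wallis.W (n + 1))⁻¹) atTop (nhds ((π / 2)⁻¹)) :=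
    ((tendsto_add_atTop_iff_nat 1).2 Wallis.tendsto_W_nhds_pi_div_two).inv₀ (by positivity)
  have h2 : Tendsto (fun n : ℕ => ((n : ℝ) + 1)⁻¹) atTop (nhds 0) := by
    simpa using tendsto_one_div_add_atTop_nhds_zero_nat (𝕜 := ℝ)
  have h3 := h1.div (h2.const_add 2) (by norm_num)
  have hl : (π / 2)⁻¹ / (2 + 0) = 1 / π := by field_simp; norm_num
  rw [hl] at h3
  refine h3.congr fun n => ?_
  rw [hW, Pi.div_apply]
  have : (2 * ((n + 1 : ℕ) : ℝ) + 1) = (2 + ((n : ℝ) + 1)⁻¹) * (n + 1) := by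
    push_cast; field_simp
  rw [this]
  field_simp

lemma tendsto_ellipticCoeff : Tendsto ellipticCoeff atTop (nhds 0) := by
  rw [← tendsto_add_atTop_iff_nat 1]
  have h2 : Tendsto (fun n : ℕ => ((n : ℝ) + 1)⁻¹) atTop (nhds 0) := by
    simpa using tendsto_one_div_add_atTop_nhds_zero_nat (𝕜 := ℝ)
  have h := tendsto_mul_ellipticCoeff.mul h2
  rw [mul_zero] at h
  refine h.congr fun n => ?_
  field_simp

/-- Sequences of at most polynomial growth. -/
def PolyBounded (a : ℕ → ℝ) : Prop := ∃ C : ℝ, ∃ k : ℕ, ∀ n : ℕ, |a n| ≤ C * ((n : ℝ) + 1) ^ k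

/-- The sum of the power series with coefficients `a`. -/
noncomputable def powerSum (a : ℕ → ℝ) (x : ℝ) : ℝ := ∑' n, a n * x ^ n

/-- Coefficients of the derivative of a power series. -/
def derivCoeff (a : ℕ → ℝ) (n : ℕ) : ℝ := (n + 1) * a (n + 1)

/-- Coefficients of `x d/dx` of a power series. -/
def eulerCoeff (a : ℕ → ℝ) (n : ℕ) : ℝ := n * a n

namespace PolyBounded

variable {a b : ℕ → ℝ}

lemma ellipticCoeff : PolyBounded ellipticCoeff :=
  ⟨1, 0, fun n => by
    simpa [abs_of_pos (ellipticCoeff_pos n)] using ellipticCoeff_le_one n⟩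

lemma euler (ha : PolyBounded a) : PolyBounded (eulerCoeff a) := by
  obtain ⟨C, k, h⟩ := ha
  refine ⟨C, k + 1, fun n => ?_⟩
  rw [eulerCoeff, abs_mul, Nat.abs_cast]
  calc (n : ℝ) * |a n| ≤ (n + 1) * (C * ((n : ℝ) + 1) ^ k) := by
        gcongr
        · linarith
        · exact h n
    _ = _ := by ring

lemma succ (ha : PolyBounded a) : PolyBounded fun n => a (n + 1) := by
  obtain ⟨C, k, h⟩ := ha
  refine ⟨C * 2 ^ k, k, fun n => (h (n + 1)).trans ?_⟩
  have hC : 0 ≤ C := by simpa using (abs_nonneg _).trans (h 0)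
  rw [mul_assoc, ← mul_pow]
  push_cast
  gcongr
  linarith [(Nat.cast_nonneg n : (0 : ℝ) ≤ n)]

lemma deriv (ha : PolyBounded a) : PolyBounded (derivCoeff a) := by
  have h := ha.euler.succ
  simp only [eulerCoeff, Nat.cast_add, Nat.cast_one] at h
  exact h

lemma summable_abs (ha : PolyBounded a) {r : ℝ} (h0 : 0 ≤ r) (h1 : r < 1) :
    Summable fun n => |a n| * r ^ n := by
  obtain ⟨C, k, h⟩ := ha
  have hC : 0 ≤ C := by simpa using (abs_nonneg _).trans (h 0)
  have hs := (summable_pow_mul_geometric_of_norm_lt_one k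
    (show ‖r‖ < 1 by rwa [Real.norm_of_nonneg h0])).mul_left (C * 2 ^ k)
  have h2 : Summable fun n => |a (n + 1)| * r ^ (n + 1) := by
    refine Summable.of_nonneg_of_le (fun n => by positivity) (fun n => ?_)
      ((summable_nat_add_iff 1).2 hs)
    have : |a (n + 1)| ≤ C * 2 ^ k * ((n + 1 : ℕ) : ℝ) ^ k := by
      refine (h (n + 1)).trans ?_
      rw [mul_assoc, ← mul_pow]
      push_cast
      gcongr
      linarith [(Nat.cast_nonneg n : (0 : ℝ) ≤ n)]
    calc |a (n + 1)| * r ^ (n + 1) ≤ C * 2 ^ k * ((n + 1 : ℕ) : ℝ) ^ k * r ^ (n + 1) := by gcongr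
      _ = _ := by ring
  exact (summable_nat_add_iff 1).1 h2

lemma summable (ha : PolyBounded a) {x : ℝ} (hx : |x| < 1) : Summable fun n => a n * x ^ n :=
  .of_abs (by simpa [abs_mul] using ha.summable_abs (abs_nonneg x) hx)

end PolyBounded

lemma powerSum_euler (a : ℕ → ℝ) (x : ℝ) :
    powerSum (eulerCoeff a) x = x * powerSum (derivCoeff a) x := by
  unfold powerSum
  rw [← tsum_mul_left, ← Function.Injective.tsum_eq (add_left_injective 1)]
  · refine tsum_congr fun n => ?_
    simp only [eulerCoeff, derivCoeff]
    push_cast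
    ring
  · rintro (_ | n) hn
    · simp [eulerCoeff] at hn
    · exact ⟨n, rfl⟩

lemma hasDerivAt_powerSum {a : ℕ → ℝ} (ha : PolyBounded a) {x : ℝ} (hx : |x| < 1) :
    HasDerivAt (powerSum a) (powerSum (derivCoeff a) x) x := by
  obtain ⟨r, hr, hr1⟩ := exists_between hx
  have hr0 : 0 < r := (abs_nonneg x).trans_lt hr
  have key := hasDerivAt_tsum_of_isPreconnected (t := Metric.ball (0 : ℝ) r)
    (g := fun n z => a n * z ^ n) (g' := fun n z => a n * (n * z ^ (n - 1)))
    (u := fun n => r⁻¹ * (|eulerCoeff a n| * r ^ n)) (y₀ := x) (y := x)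
    ((ha.euler.summable_abs hr0.le hr1).mul_left _) Metric.isOpen_ball
    (convex_ball _ _).isPreconnected
    (fun n z _ => (hasDerivAt_pow n z).const_mul (a n)) (fun n z hz => ?_)
    (by simpa using hr) (ha.summable hx) (by simpa using hr)
  · refine key.congr_deriv ?_
    unfold powerSum
    rw [← Function.Injective.tsum_eq (add_left_injective 1)
      (f := fun n => a n * (n * x ^ (n - 1)))]
    · refine tsum_congr fun n => ?_
      simp only [derivCoeff, Nat.add_sub_cancel]
      push_cast
      ring
    · rintro (_ | n) hn
      · simp at hn
      · exact ⟨n, rfl⟩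
  · rcases n with _ | n
    · simp [eulerCoeff]
    · have hz' : |z| ≤ r := by simpa using (Metric.mem_ball.1 hz).le
      simp only [eulerCoeff, Nat.add_sub_cancel, norm_mul, norm_pow, Real.norm_eq_abs, abs_mul]
      rw [pow_succ r, show r⁻¹ * (|((n + 1 : ℕ) : ℝ)| * |a (n + 1)| * (r ^ n * r))
        = |a (n + 1)| * (|((n + 1 : ℕ) : ℝ)| * r ^ n) by field_simp]
      gcongr

/-- An Abelian theorem: `(1 - x) ∑ bₙ xⁿ` tends to `lim bₙ` as `x → 1⁻`. -/
lemma tendsto_one_sub_mul_powerSum {b : ℕ → ℝ} (hb : PolyBounded b) {l : ℝ}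
    (h : Tendsto b atTop (nhds l)) :
    Tendsto (fun x => (1 - x) * powerSum b x) (nhdsWithin 1 (Set.Iio 1)) (nhds l) := by
  set d : ℕ → ℝ := fun n => b n - (if n = 0 then 0 else b (n - 1)) with hd
  have hsum : ∀ n, ∑ i ∈ Finset.range (n + 1), d i = b n := by
    intro n
    induction n with
    | zero => simp [hd]
    | succ n ih => rw [Finset.sum_range_succ, ih]; simp [hd]
  have ht : Tendsto (fun n => ∑ i ∈ Finset.range n, d i) atTop (nhds l) := by
    rw [← tendsto_add_atTop_iff_nat 1]
    simpa only [hsum] using h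
  refine (Real.tendsto_tsum_powerSeries_nhdsWithin_lt ht).congr' ?_
  have hmem : Set.Ioo (0 : ℝ) 1 ∈ nhdsWithin (1 : ℝ) (Set.Iio 1) :=
    Ioo_mem_nhdsLT (by norm_num)
  filter_upwards [hmem] with x hx
  have hx1 : |x| < 1 := by rw [abs_of_pos hx.1]; exact hx.2
  have hs := hb.summable hx1
  have hs' : Summable fun n => (if n = 0 then 0 else b (n - 1)) * x ^ n := by
    rw [← summable_nat_add_iff 1]
    refine (hs.mul_left x).congr fun n => ?_
    simp; ring
  have h2 : ∑' n, (if n = 0 then 0 else b (n - 1)) * x ^ n = x * powerSum b x := by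
    rw [hs'.tsum_eq_zero_add, powerSum, ← tsum_mul_left]
    simp only [if_true, zero_mul, zero_add]
    refine tsum_congr fun n => ?_
    simp; ring
  simp only [hd, sub_mul]
  rw [hs.tsum_sub hs', h2, powerSum]
  ring

/-- The function `(2/π) K`, with `K` the complete elliptic integral as a function of `m = k²`. -/
noncomputable def ellA : ℝ → ℝ := powerSum ellipticCoeff

/-- The derivative of `ellA`. -/
noncomputable def ellA' : ℝ → ℝ := powerSum (derivCoeff ellipticCoeff)

lemma ellA_zero : ellA 0 = 1 := by
  unfold ellA powerSum
  rw [tsum_eq_single 0]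
  · simp [ellipticCoeff_zero]
  · intro n hn
    simp [hn]

lemma hasDerivAt_ellA {x : ℝ} (hx : |x| < 1) : HasDerivAt ellA (ellA' x) x :=
  hasDerivAt_powerSum .ellipticCoeff hx

lemma hasDerivAt_ellA' {x : ℝ} (hx : |x| < 1) :
    HasDerivAt ellA' (powerSum (derivCoeff (derivCoeff ellipticCoeff)) x) x :=
  hasDerivAt_powerSum (PolyBounded.ellipticCoeff.deriv) hx

/-- The differential equation of the complete elliptic integral in self-adjoint form. -/
lemma hasDerivAt_ellA_weighted {x : ℝ} (hx : |x| < 1) :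
    HasDerivAt (fun x => x * (1 - x) * ellA' x) (ellA x / 4) x := by
  have hu := PolyBounded.ellipticCoeff
  have h1 := ((hasDerivAt_id x).const_sub 1).mul (hasDerivAt_powerSum hu.euler hx)
  have hfun : (fun x => x * (1 - x) * ellA' x)
      = (fun x => (1 - id x) * powerSum (eulerCoeff ellipticCoeff) x) := by
    funext z
    rw [powerSum_euler, ellA', id]
    ring
  rw [hfun]
  refine h1.congr_deriv ?_
  set F := powerSum (derivCoeff (eulerCoeff ellipticCoeff)) x with hF
  have hF1 : F = powerSum (eulerCoeff (eulerCoeff ellipticCoeff)) x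
      + powerSum (eulerCoeff ellipticCoeff) x + powerSum ellipticCoeff x / 4 := by
    rw [hF]
    unfold powerSum
    rw [← tsum_div_const, ← (hu.euler.euler.summable hx).tsum_add (hu.euler.summable hx),
      ← ((hu.euler.euler.summable hx).add (hu.euler.summable hx)).tsum_add
        ((hu.summable hx).div_const 4)]
    refine tsum_congr fun n => ?_
    simp only [eulerCoeff, derivCoeff]
    push_cast
    linear_combination x ^ n * ellipticCoeff_succ n
  rw [powerSum_euler (eulerCoeff ellipticCoeff), ← hF] at hF1
  simp only [ellA, id]
  linear_combination hF1

lemma ellA_pos {x : ℝ} (hx : |x| < 1 / 2) : 0 < ellA x := by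
  have hu := PolyBounded.ellipticCoeff
  have hx1 : |x| < 1 := by linarith
  have hg : HasSum (fun n : ℕ => |x| ^ n) (1 - |x|)⁻¹ :=
    hasSum_geometric_of_lt_one (abs_nonneg x) hx1
  have hs := (hu.summable hx1)
  have h1 := hs.tsum_eq_zero_add
  have hs' := (summable_nat_add_iff 1).2 hs
  have h2 : |∑' n, ellipticCoeff (n + 1) * x ^ (n + 1)| ≤ |x| * (1 - |x|)⁻¹ := by
    rw [← Real.norm_eq_abs]
    refine tsum_of_norm_bounded (hg.mul_left |x|) fun n => ?_
    rw [norm_mul, norm_pow, Real.norm_of_nonneg (ellipticCoeff_pos _).le, Real.norm_eq_abs,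
      ← pow_succ']
    exact mul_le_of_le_one_left (by positivity) (ellipticCoeff_le_one _)
  have h3 : |x| * (1 - |x|)⁻¹ < 1 := by
    rw [← div_eq_mul_inv, div_lt_one (by linarith)]
    linarith
  have h4 : ellA x = 1 + ∑' n, ellipticCoeff (n + 1) * x ^ (n + 1) := by
    simpa [ellA, powerSum, ellipticCoeff_zero] using h1
  rw [h4]
  linarith [(abs_lt.1 (h2.trans_lt h3)).1]

lemma tendsto_one_sub_mul_ellA :
    Tendsto (fun x => (1 - x) * ellA x) (nhdsWithin 1 (Set.Iio 1)) (nhds 0) :=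
  tendsto_one_sub_mul_powerSum .ellipticCoeff tendsto_ellipticCoeff

lemma tendsto_one_sub_mul_ellA' :
    Tendsto (fun x => (1 - x) * ellA' x) (nhdsWithin 1 (Set.Iio 1)) (nhds (1 / π)) :=
  tendsto_one_sub_mul_powerSum PolyBounded.ellipticCoeff.deriv tendsto_mul_ellipticCoeff

/-- Coefficients of double power series that converge absolutely, with polynomial weights, on
the bidisc of radii `U` and `V`. -/
def WeightedSummable (U V : ℝ) (a : ℕ × ℕ → ℝ) : Prop :=
  ∀ k : ℕ, Summable fun p : ℕ × ℕ => ((p.1 : ℝ) + p.2 + 1) ^ k * (|a p| * U ^ p.1 * V ^ p.2)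

/-- The sum of the double power series with coefficients `a`. -/
noncomputable def doubleSum (a : ℕ × ℕ → ℝ) (u v : ℝ) : ℝ := ∑' p : ℕ × ℕ, a p * u ^ p.1 * v ^ p.2

/-- Coefficients of `∂/∂u` of a double power series. -/
def partial₁ (a : ℕ × ℕ → ℝ) (p : ℕ × ℕ) : ℝ := (p.1 + 1) * a (p.1 + 1, p.2)

/-- Coefficients of `∂/∂v` of a double power series. -/
def partial₂ (a : ℕ × ℕ → ℝ) (p : ℕ × ℕ) : ℝ := (p.2 + 1) * a (p.1, p.2 + 1)

/-- Coefficients of `u ∂/∂u` of a double power series. -/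
def euler₁ (a : ℕ × ℕ → ℝ) (p : ℕ × ℕ) : ℝ := p.1 * a p

/-- Coefficients of `v ∂/∂v` of a double power series. -/
def euler₂ (a : ℕ × ℕ → ℝ) (p : ℕ × ℕ) : ℝ := p.2 * a p

lemma tsum_succ_fst {f : ℕ × ℕ → ℝ} (hf : ∀ j, f (0, j) = 0) :
    ∑' p : ℕ × ℕ, f (p.1 + 1, p.2) = ∑' p, f p := by
  refine Function.Injective.tsum_eq (g := fun p : ℕ × ℕ => (p.1 + 1, p.2)) ?_ ?_
  · rintro ⟨i, j⟩ ⟨k, l⟩ h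
    simpa using h
  · rintro ⟨_ | i, j⟩ h
    · exact absurd (hf j) h
    · exact ⟨(i, j), rfl⟩

lemma tsum_succ_snd {f : ℕ × ℕ → ℝ} (hf : ∀ i, f (i, 0) = 0) :
    ∑' p : ℕ × ℕ, f (p.1, p.2 + 1) = ∑' p, f p := by
  refine Function.Injective.tsum_eq (g := fun p : ℕ × ℕ => (p.1, p.2 + 1)) ?_ ?_
  · rintro ⟨i, j⟩ ⟨k, l⟩ h
    simpa using h
  · rintro ⟨i, _ | j⟩ h
    · exact absurd (hf i) h
    · exact ⟨(i, j), rfl⟩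

lemma doubleSum_euler₁ (a : ℕ × ℕ → ℝ) (u v : ℝ) :
    doubleSum (euler₁ a) u v = u * doubleSum (partial₁ a) u v := by
  unfold doubleSum
  rw [← tsum_mul_left, ← tsum_succ_fst fun j => by simp [euler₁]]
  refine tsum_congr fun p => ?_
  simp only [euler₁, partial₁]
  push_cast
  ring

lemma doubleSum_euler₂ (a : ℕ × ℕ → ℝ) (u v : ℝ) :
    doubleSum (euler₂ a) u v = v * doubleSum (partial₂ a) u v := by
  unfold doubleSum
  rw [← tsum_mul_left, ← tsum_succ_snd fun j => by simp [euler₂]]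
  refine tsum_congr fun p => ?_
  simp only [euler₂, partial₂]
  push_cast
  ring

namespace WeightedSummable

variable {U V : ℝ} {a b : ℕ × ℕ → ℝ}

lemma of_le (hU : 0 < U) (hV : 0 < V) (ha : WeightedSummable U V a) {C : ℝ} {m : ℕ}
    (h : ∀ p : ℕ × ℕ, |b p| ≤ C * (((p.1 : ℝ) + p.2 + 1) ^ m * |a p|)) :
    WeightedSummable U V b := by
  intro k
  refine Summable.of_nonneg_of_le (fun p => by positivity) (fun p => ?_) ((ha (k + m)).mul_left C)
  calc ((p.1 : ℝ) + p.2 + 1) ^ k * (|b p| * U ^ p.1 * V ^ p.2)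
      ≤ ((p.1 : ℝ) + p.2 + 1) ^ k *
        (C * (((p.1 : ℝ) + p.2 + 1) ^ m * |a p|) * U ^ p.1 * V ^ p.2) := by gcongr; exact h p
    _ = _ := by ring

lemma euler₁ (hU : 0 < U) (hV : 0 < V) (ha : WeightedSummable U V a) :
    WeightedSummable U V (euler₁ a) := by
  refine ha.of_le hU hV (C := 1) (m := 1) fun p => ?_
  rw [_root_.euler₁, abs_mul, Nat.abs_cast, pow_one, one_mul]
  gcongr
  linarith [(Nat.cast_nonneg p.2 : (0 : ℝ) ≤ p.2)]

lemma euler₂ (hU : 0 < U) (hV : 0 < V) (ha : WeightedSummable U V a) :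
    WeightedSummable U V (euler₂ a) := by
  refine ha.of_le hU hV (C := 1) (m := 1) fun p => ?_
  rw [_root_.euler₂, abs_mul, Nat.abs_cast, pow_one, one_mul]
  gcongr
  linarith [(Nat.cast_nonneg p.1 : (0 : ℝ) ≤ p.1)]

lemma partial₁ (hU : 0 < U) (hV : 0 < V) (ha : WeightedSummable U V a) :
    WeightedSummable U V (partial₁ a) := by
  intro k
  have hinj : Function.Injective fun p : ℕ × ℕ => (p.1 + 1, p.2) := by
    rintro ⟨i, j⟩ ⟨k, l⟩ h
    simpa using h
  refine Summable.of_nonneg_of_le (fun p => by positivity) (fun p => ?_)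
    (((ha.euler₁ hU hV k).comp_injective hinj).mul_left U⁻¹)
  simp only [Function.comp, _root_.euler₁, _root_.partial₁]
  push_cast
  rw [show U⁻¹ * (((p.1 : ℝ) + 1 + p.2 + 1) ^ k *
      (|((p.1 : ℝ) + 1) * a (p.1 + 1, p.2)| * U ^ (p.1 + 1) * V ^ p.2))
    = ((p.1 : ℝ) + 1 + p.2 + 1) ^ k *
      (|((p.1 : ℝ) + 1) * a (p.1 + 1, p.2)| * U ^ p.1 * V ^ p.2) by rw [pow_succ]; field_simp]
  gcongr
  linarith

lemma partial₂ (hU : 0 < U) (hV : 0 < V) (ha : WeightedSummable U V a) :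
    WeightedSummable U V (partial₂ a) := by
  intro k
  have hinj : Function.Injective fun p : ℕ × ℕ => (p.1, p.2 + 1) := by
    rintro ⟨i, j⟩ ⟨k, l⟩ h
    simpa using h
  refine Summable.of_nonneg_of_le (fun p => by positivity) (fun p => ?_)
    (((ha.euler₂ hU hV k).comp_injective hinj).mul_left V⁻¹)
  simp only [Function.comp, _root_.euler₂, _root_.partial₂]
  push_cast
  rw [show V⁻¹ * (((p.1 : ℝ) + (p.2 + 1) + 1) ^ k *
      (|((p.2 : ℝ) + 1) * a (p.1, p.2 + 1)| * U ^ p.1 * V ^ (p.2 + 1)))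
    = ((p.1 : ℝ) + (p.2 + 1) + 1) ^ k *
      (|((p.2 : ℝ) + 1) * a (p.1, p.2 + 1)| * U ^ p.1 * V ^ p.2) by rw [pow_succ]; field_simp]
  gcongr
  linarith

lemma add (hU : 0 < U) (hV : 0 < V) (ha : WeightedSummable U V a) (hb : WeightedSummable U V b) :
    WeightedSummable U V fun p => a p + b p := by
  intro k
  refine Summable.of_nonneg_of_le (fun p => by positivity) (fun p => ?_) ((ha k).add (hb k))
  rw [← mul_add, ← add_mul, ← add_mul]
  gcongr
  exact abs_add_le _ _

lemma const_mul (hU : 0 < U) (hV : 0 < V) (ha : WeightedSummable U V a) (c : ℝ) :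
    WeightedSummable U V fun p => c * a p :=
  ha.of_le hU hV (C := |c|) (m := 0) fun p => by simp [abs_mul]

lemma summable (hU : 0 < U) (ha : WeightedSummable U V a) {u v : ℝ} (hu : |u| ≤ U)
    (hv : |v| ≤ V) : Summable fun p : ℕ × ℕ => a p * u ^ p.1 * v ^ p.2 := by
  refine .of_norm_bounded (ha 0) fun p => ?_
  rw [norm_mul, norm_mul, norm_pow, norm_pow, pow_zero, one_mul]
  simp only [Real.norm_eq_abs]
  gcongr

end WeightedSummable

lemma doubleSum_add {U V : ℝ} (hU : 0 < U) {a b : ℕ × ℕ → ℝ}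
    (ha : WeightedSummable U V a) (hb : WeightedSummable U V b) {u v : ℝ} (hu : |u| ≤ U)
    (hv : |v| ≤ V) :
    doubleSum (fun p => a p + b p) u v = doubleSum a u v + doubleSum b u v := by
  unfold doubleSum
  rw [← (ha.summable hU hu hv).tsum_add (hb.summable hU hu hv)]
  exact tsum_congr fun p => by ring

lemma doubleSum_const_mul (c : ℝ) (a : ℕ × ℕ → ℝ) (u v : ℝ) :
    doubleSum (fun p => c * a p) u v = c * doubleSum a u v := by
  unfold doubleSum
  rw [← tsum_mul_left]
  exact tsum_congr fun p => by ring

/-- The chain rule for a double power series along a line. -/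
lemma hasDerivAt_doubleSum {U V : ℝ} (hU : 0 < U) (hV : 0 < V) {a : ℕ × ℕ → ℝ}
    (ha : WeightedSummable U V a) {t : Set ℝ} (ht : IsOpen t) (htc : IsPreconnected t)
    {u v : ℝ → ℝ} {u' v' : ℝ} (hu : ∀ z ∈ t, HasDerivAt u u' z) (hv : ∀ z ∈ t, HasDerivAt v v' z)
    (huU : ∀ z ∈ t, |u z| ≤ U) (hvV : ∀ z ∈ t, |v z| ≤ V) {x : ℝ} (hx : x ∈ t) :
    HasDerivAt (fun z => doubleSum a (u z) (v z))
      (u' * doubleSum (partial₁ a) (u x) (v x) + v' * doubleSum (partial₂ a) (u x) (v x)) x := by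
  have hb₁ : ∀ (p : ℕ × ℕ) (z w : ℝ), |z| ≤ U → |w| ≤ V →
      |a p * (p.1 * z ^ (p.1 - 1)) * w ^ p.2| ≤ U⁻¹ * (|euler₁ a p| * U ^ p.1 * V ^ p.2) := by
    rintro ⟨_ | i, j⟩ z w hz hw
    · simp [euler₁]
    · simp only [euler₁, Nat.add_sub_cancel, abs_mul, abs_pow]
      rw [show U⁻¹ * (|((i + 1 : ℕ) : ℝ)| * |a (i + 1, j)| * U ^ (i + 1) * V ^ j)
        = |a (i + 1, j)| * (|((i + 1 : ℕ) : ℝ)| * U ^ i) * V ^ j by rw [pow_succ]; field_simp]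
      gcongr
  have hb₂ : ∀ (p : ℕ × ℕ) (z w : ℝ), |z| ≤ U → |w| ≤ V →
      |a p * z ^ p.1 * (p.2 * w ^ (p.2 - 1))| ≤ V⁻¹ * (|euler₂ a p| * U ^ p.1 * V ^ p.2) := by
    rintro ⟨i, _ | j⟩ z w hz hw
    · simp [euler₂]
    · simp only [euler₂, Nat.add_sub_cancel, abs_mul, abs_pow]
      rw [show V⁻¹ * (|((j + 1 : ℕ) : ℝ)| * |a (i, j + 1)| * U ^ i * V ^ (j + 1))
        = |a (i, j + 1)| * U ^ i * (|((j + 1 : ℕ) : ℝ)| * V ^ j) by rw [pow_succ]; field_simp]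
      gcongr
  have hs₁ := ((ha.euler₁ hU hV) 0).mul_left U⁻¹
  have hs₂ := ((ha.euler₂ hU hV) 0).mul_left V⁻¹
  simp only [pow_zero, one_mul] at hs₁ hs₂
  have hd : ∀ (p : ℕ × ℕ), ∀ z ∈ t, HasDerivAt (fun z => a p * u z ^ p.1 * v z ^ p.2)
      (u' * (a p * (p.1 * u z ^ (p.1 - 1)) * v z ^ p.2)
        + v' * (a p * u z ^ p.1 * (p.2 * v z ^ (p.2 - 1)))) z := by
    intro p z hz
    refine ((((hu z hz).fun_pow p.1).const_mul (a p)).fun_mul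
      ((hv z hz).fun_pow p.2)).congr_deriv ?_
    ring
  have key := hasDerivAt_tsum_of_isPreconnected
    (g := fun (p : ℕ × ℕ) z => a p * u z ^ p.1 * v z ^ p.2)
    (g' := fun (p : ℕ × ℕ) z => u' * (a p * (p.1 * u z ^ (p.1 - 1)) * v z ^ p.2)
      + v' * (a p * u z ^ p.1 * (p.2 * v z ^ (p.2 - 1))))
    ((hs₁.mul_left |u'|).add (hs₂.mul_left |v'|)) ht htc
    hd (fun p z hz => ?_) hx (ha.summable hU (huU x hx) (hvV x hx)) hx
  · have ht₁ : Summable fun p : ℕ × ℕ => a p * (p.1 * u x ^ (p.1 - 1)) * v x ^ p.2 :=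
      Summable.of_norm_bounded hs₁ fun p => hb₁ p _ _ (huU x hx) (hvV x hx)
    have ht₂ : Summable fun p : ℕ × ℕ => a p * u x ^ p.1 * (p.2 * v x ^ (p.2 - 1)) :=
      Summable.of_norm_bounded hs₂ fun p => hb₂ p _ _ (huU x hx) (hvV x hx)
    have hd₁ : doubleSum (partial₁ a) (u x) (v x)
        = ∑' p : ℕ × ℕ, a p * (p.1 * u x ^ (p.1 - 1)) * v x ^ p.2 := by
      rw [← tsum_succ_fst (f := fun p => a p * (p.1 * u x ^ (p.1 - 1)) * v x ^ p.2)
        fun j => by simp]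
      refine tsum_congr fun p => ?_
      simp only [partial₁, Nat.add_sub_cancel]
      push_cast
      ring
    have hd₂ : doubleSum (partial₂ a) (u x) (v x)
        = ∑' p : ℕ × ℕ, a p * u x ^ p.1 * (p.2 * v x ^ (p.2 - 1)) := by
      rw [← tsum_succ_snd (f := fun p => a p * u x ^ p.1 * (p.2 * v x ^ (p.2 - 1)))
        fun j => by simp]
      refine tsum_congr fun p => ?_
      simp only [partial₂, Nat.add_sub_cancel]
      push_cast
      ring
    refine key.congr_deriv ?_
    rw [hd₁, hd₂, ← tsum_mul_left, ← tsum_mul_left,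
      (ht₁.mul_left u').tsum_add (ht₂.mul_left v')]
  · simp only [Real.norm_eq_abs]
    refine (abs_add_le _ _).trans (add_le_add ?_ ?_)
    · rw [abs_mul]
      exact mul_le_mul_of_nonneg_left (hb₁ p _ _ (huU z hz) (hvV z hz)) (abs_nonneg _)
    · rw [abs_mul]
      exact mul_le_mul_of_nonneg_left (hb₂ p _ _ (huU z hz) (hvV z hz)) (abs_nonneg _)

/-- Coefficients of Appell's function `F₄(1/2, 1/2; 1, 1)`. -/
noncomputable def appellCoeff (p : ℕ × ℕ) : ℝ :=
  ellipticCoeff (p.1 + p.2) * ((p.1 + p.2).choose p.1 : ℝ) ^ 2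

lemma appellCoeff_succ_fst (i j : ℕ) :
    ((i : ℝ) + 1) ^ 2 * appellCoeff (i + 1, j)
      = ((i : ℝ) + j + 1 / 2) ^ 2 * appellCoeff (i, j) := by
  have h1 : ((i : ℝ) + j + 1) * ((i + j).choose i : ℝ)
      = ((i + j + 1).choose (i + 1) : ℝ) * (i + 1) := by
    exact_mod_cast Nat.add_one_mul_choose_eq (i + j) i
  have h2 := ellipticCoeff_succ (i + j)
  push_cast at h2
  have h3 : i + 1 + j = i + j + 1 := by ring
  simp only [appellCoeff, h3]
  have h4 : ((i : ℝ) + 1) ^ 2 * (ellipticCoeff (i + j + 1) * ((i + j + 1).choose (i + 1) : ℝ) ^ 2)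
      = ellipticCoeff (i + j + 1) * (((i : ℝ) + j + 1) * ((i + j).choose i : ℝ)) ^ 2 := by
    rw [h1]; ring
  rw [h4]
  linear_combination ((i + j).choose i : ℝ) ^ 2 * h2

lemma appellCoeff_succ_snd (i j : ℕ) :
    ((j : ℝ) + 1) ^ 2 * appellCoeff (i, j + 1)
      = ((i : ℝ) + j + 1 / 2) ^ 2 * appellCoeff (i, j) := by
  have h1 : ((i : ℝ) + j + 1) * ((i + j).choose i : ℝ)
      = ((i + j + 1).choose i : ℝ) * (j + 1) := by
    have := Nat.choose_mul_succ_eq (i + j) i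
    rw [show i + j + 1 - i = j + 1 by omega] at this
    rw [mul_comm]
    exact_mod_cast this
  have h2 := ellipticCoeff_succ (i + j)
  push_cast at h2
  simp only [appellCoeff, ← add_assoc]
  have h4 : ((j : ℝ) + 1) ^ 2 * (ellipticCoeff (i + j + 1) * ((i + j + 1).choose i : ℝ) ^ 2)
      = ellipticCoeff (i + j + 1) * (((i : ℝ) + j + 1) * ((i + j).choose i : ℝ)) ^ 2 := by
    rw [h1]; ring
  rw [h4]
  linear_combination ((i + j).choose i : ℝ) ^ 2 * h2

lemma summable_prod_of_antidiagonal {f : ℕ × ℕ → ℝ} (hf : ∀ p, 0 ≤ f p)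
    (h : Summable fun n => ∑ p ∈ Finset.HasAntidiagonal.antidiagonal n, f p) : Summable f := by
  rw [← Finset.HasAntidiagonal.sigmaAntidiagonalEquivProd.summable_iff]
  refine (summable_sigma_of_nonneg fun x => hf _).2
    ⟨fun n => (hasSum_fintype _).summable, h.congr fun n => ?_⟩
  rw [tsum_fintype]
  exact (Finset.sum_coe_sort (Finset.HasAntidiagonal.antidiagonal n) f).symm

lemma weightedSummable_appellCoeff {s t : ℝ} (hs : 0 < s) (ht : 0 < t) (hst : s + t < 1) :
    WeightedSummable (s ^ 2) (t ^ 2) appellCoeff := by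
  have hb : ∀ p : ℕ × ℕ, ((p.1 + p.2).choose p.1 : ℝ) * s ^ p.1 * t ^ p.2
      ≤ (s + t) ^ (p.1 + p.2) := by
    intro p
    rw [add_pow]
    refine le_trans (le_of_eq ?_) (Finset.single_le_sum
      (f := fun m => s ^ m * t ^ (p.1 + p.2 - m) * ((p.1 + p.2).choose m : ℝ))
      (fun _ _ => by positivity) (Finset.mem_range.2 (show p.1 < p.1 + p.2 + 1 by omega)))
    simp only [Nat.add_sub_cancel_left]
    ring
  intro k
  have hmaj : Summable fun p : ℕ × ℕ => ((p.1 : ℝ) + p.2 + 1) ^ k *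
      (((p.1 + p.2).choose p.1 : ℝ) * s ^ p.1 * t ^ p.2) := by
    refine summable_prod_of_antidiagonal (fun p => ?_) ?_
    · positivity
    have hg : Summable fun n : ℕ => (n : ℝ) ^ k * (s + t) ^ n :=
      summable_pow_mul_geometric_of_norm_lt_one k
        (by rwa [Real.norm_of_nonneg (add_pos hs ht).le])
    have h := (summable_nat_add_iff 1).2 hg
    refine (h.mul_left (s + t)⁻¹).congr fun n => ?_
    have h2 : ∀ p ∈ Finset.HasAntidiagonal.antidiagonal n, ((p.1 : ℝ) + p.2 + 1) ^ k *
        (((p.1 + p.2).choose p.1 : ℝ) * s ^ p.1 * t ^ p.2)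
        = ((n : ℝ) + 1) ^ k * (n.choose p.1 • (s ^ p.1 * t ^ p.2)) := by
      intro p hp
      rw [← Finset.HasAntidiagonal.mem_antidiagonal.1 hp]
      push_cast
      rw [nsmul_eq_mul]
      ring
    rw [Finset.sum_congr rfl h2, ← Finset.mul_sum, ← (Commute.all s t).add_pow']
    push_cast
    rw [pow_succ]
    field_simp
  refine Summable.of_nonneg_of_le (fun p => by positivity) (fun p => ?_) hmaj
  have h0 : 0 ≤ ((p.1 + p.2).choose p.1 : ℝ) * s ^ p.1 * t ^ p.2 := by positivity
  have h1 : ((p.1 + p.2).choose p.1 : ℝ) * s ^ p.1 * t ^ p.2 ≤ 1 :=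
    (hb p).trans (pow_le_one₀ (by positivity) hst.le)
  have he := ellipticCoeff_pos (p.1 + p.2)
  have he1 := ellipticCoeff_le_one (p.1 + p.2)
  have heq : |appellCoeff p| * (s ^ 2) ^ p.1 * (t ^ 2) ^ p.2 = ellipticCoeff (p.1 + p.2) *
      (((p.1 + p.2).choose p.1 : ℝ) * s ^ p.1 * t ^ p.2) ^ 2 := by
    rw [appellCoeff, abs_of_nonneg (by positivity)]
    ring
  rw [heq]
  refine mul_le_mul_of_nonneg_left ?_ (by positivity)
  calc _ ≤ 1 * (((p.1 + p.2).choose p.1 : ℝ) * s ^ p.1 * t ^ p.2) ^ 2 := by gcongr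
    _ ≤ _ := by nlinarith

lemma partial₁_euler₁_appellCoeff : partial₁ (euler₁ appellCoeff)
    = fun p => ((p.1 : ℝ) + p.2 + 1 / 2) ^ 2 * appellCoeff p := by
  funext p
  rw [← appellCoeff_succ_fst]
  simp only [partial₁, euler₁]
  push_cast
  ring

lemma partial₂_euler₂_appellCoeff : partial₂ (euler₂ appellCoeff)
    = fun p => ((p.1 : ℝ) + p.2 + 1 / 2) ^ 2 * appellCoeff p := by
  funext p
  rw [← appellCoeff_succ_snd]
  simp only [partial₂, euler₂]
  push_cast
  ring

lemma weightedSummable_appellCoeff_box :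
    WeightedSummable (4 / 25) (121 / 400) appellCoeff := by
  have := weightedSummable_appellCoeff (s := 2 / 5) (t := 11 / 20) (by norm_num) (by norm_num)
    (by norm_num)
  norm_num at this
  exact this

/-- The product form of Appell's function, before the factorization is known. -/
noncomputable def appellF (x y : ℝ) : ℝ := doubleSum appellCoeff (x * (1 - y)) (y * (1 - x))

/-- The derivative of `appellF` in the first variable times `x (1 - x)`. -/
noncomputable def appellM (x y : ℝ) : ℝ :=
  (1 - x) * doubleSum (euler₁ appellCoeff) (x * (1 - y)) (y * (1 - x))
    - x * doubleSum (euler₂ appellCoeff) (x * (1 - y)) (y * (1 - x))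

lemma box_bounds {x y : ℝ} (hx : |x| < 127 / 1000) (hy : |y| < 51 / 200) :
    |x * (1 - y)| ≤ 4 / 25 ∧ |y * (1 - x)| ≤ 121 / 400 := by
  have h1 : |1 - y| ≤ 1 + |y| := by simpa using abs_sub (1 : ℝ) y
  have h2 : |1 - x| ≤ 1 + |x| := by simpa using abs_sub (1 : ℝ) x
  rw [abs_mul, abs_mul]
  constructor <;> nlinarith [abs_nonneg x, abs_nonneg y]

lemma hasDerivAt_doubleSum_fst {a : ℕ × ℕ → ℝ} (ha : WeightedSummable (4 / 25) (121 / 400) a)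
    {x y : ℝ} (hx : |x| < 127 / 1000) (hy : |y| < 51 / 200) :
    HasDerivAt (fun x => doubleSum a (x * (1 - y)) (y * (1 - x)))
      ((1 - y) * doubleSum (partial₁ a) (x * (1 - y)) (y * (1 - x))
        + -y * doubleSum (partial₂ a) (x * (1 - y)) (y * (1 - x))) x := by
  refine hasDerivAt_doubleSum (t := Metric.ball 0 (127 / 1000)) (by norm_num) (by norm_num) ha
    Metric.isOpen_ball (convex_ball _ _).isPreconnected (u := fun x => x * (1 - y))
    (v := fun x => y * (1 - x)) (fun z _ => ?_) (fun z _ => ?_) (fun z hz => ?_) (fun z hz => ?_)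
    (by simpa using hx)
  · simpa using (hasDerivAt_id z).mul_const (1 - y)
  · simpa using ((hasDerivAt_id z).const_sub 1).const_mul y
  · exact (box_bounds (by simpa using hz) hy).1
  · exact (box_bounds (by simpa using hz) hy).2

lemma hasDerivAt_doubleSum_snd {a : ℕ × ℕ → ℝ} (ha : WeightedSummable (4 / 25) (121 / 400) a)
    {x y : ℝ} (hx : |x| < 127 / 1000) (hy : |y| < 51 / 200) :
    HasDerivAt (fun y => doubleSum a (x * (1 - y)) (y * (1 - x)))
      (-x * doubleSum (partial₁ a) (x * (1 - y)) (y * (1 - x))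
        + (1 - x) * doubleSum (partial₂ a) (x * (1 - y)) (y * (1 - x))) y := by
  refine hasDerivAt_doubleSum (t := Metric.ball 0 (51 / 200)) (by norm_num) (by norm_num) ha
    Metric.isOpen_ball (convex_ball _ _).isPreconnected (u := fun y => x * (1 - y))
    (v := fun y => y * (1 - x)) (fun z _ => ?_) (fun z _ => ?_) (fun z hz => ?_) (fun z hz => ?_)
    (by simpa using hy)
  · simpa using ((hasDerivAt_id z).const_sub 1).const_mul x
  · simpa using (hasDerivAt_id z).mul_const (1 - x)
  · exact (box_bounds hx (by simpa using hz)).1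
  · exact (box_bounds hx (by simpa using hz)).2

lemma appellM_eq (x y : ℝ) :
    appellM x y = x * (1 - x) *
      ((1 - y) * doubleSum (partial₁ appellCoeff) (x * (1 - y)) (y * (1 - x))
        + -y * doubleSum (partial₂ appellCoeff) (x * (1 - y)) (y * (1 - x))) := by
  rw [appellM, doubleSum_euler₁, doubleSum_euler₂]
  ring

lemma hasDerivAt_appellM {x y : ℝ} (hx : |x| < 127 / 1000) (hy : |y| < 51 / 200) :
    HasDerivAt (fun x => appellM x y) (appellF x y / 4) x := by
  have hU : (0 : ℝ) < 4 / 25 := by norm_num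
  have hV : (0 : ℝ) < 121 / 400 := by norm_num
  have hc := weightedSummable_appellCoeff_box
  obtain ⟨hu, hv⟩ := box_bounds hx hy
  have h1 := ((hasDerivAt_id x).const_sub 1).mul (hasDerivAt_doubleSum_fst (hc.euler₁ hU hV) hx hy)
  have h2 := (hasDerivAt_id x).mul (hasDerivAt_doubleSum_fst (hc.euler₂ hU hV) hx hy)
  refine (h1.sub h2).congr_deriv ?_
  simp only [id]
  rw [appellF]
  set u := x * (1 - y) with hu_def
  set v := y * (1 - x) with hv_def
  have e12 : doubleSum (euler₁ (euler₂ appellCoeff)) u v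
      = u * doubleSum (partial₁ (euler₂ appellCoeff)) u v := doubleSum_euler₁ _ _ _
  have e21 : doubleSum (euler₁ (euler₂ appellCoeff)) u v
      = v * doubleSum (partial₂ (euler₁ appellCoeff)) u v := by
    rw [← doubleSum_euler₂]
    congr 1
    funext p
    simp only [euler₁, euler₂]
    ring
  have e11 : doubleSum (euler₁ (euler₁ appellCoeff)) u v
      = u * doubleSum (partial₁ (euler₁ appellCoeff)) u v := doubleSum_euler₁ _ _ _
  have e22 : doubleSum (euler₂ (euler₂ appellCoeff)) u v
      = v * doubleSum (partial₂ (euler₂ appellCoeff)) u v := doubleSum_euler₂ _ _ _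
  rw [partial₁_euler₁_appellCoeff] at *
  rw [partial₂_euler₂_appellCoeff] at *
  set E := doubleSum (fun p => ((p.1 : ℝ) + p.2 + 1 / 2) ^ 2 * appellCoeff p) u v with hE
  have hE' : E = doubleSum (euler₁ (euler₁ appellCoeff)) u v
      + 2 * doubleSum (euler₁ (euler₂ appellCoeff)) u v
      + doubleSum (euler₂ (euler₂ appellCoeff)) u v + doubleSum (euler₁ appellCoeff) u v
      + doubleSum (euler₂ appellCoeff) u v + 1 / 4 * doubleSum appellCoeff u v := by
    have w1 := hc.euler₁ hU hV
    have w2 := hc.euler₂ hU hV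
    have w11 := w1.euler₁ hU hV
    have w12 := (w2.euler₁ hU hV).const_mul hU hV 2
    have w22 := w2.euler₂ hU hV
    have w0 := hc.const_mul hU hV (1 / 4)
    have s1 := w11.add hU hV w12
    have s2 := s1.add hU hV w22
    have s3 := s2.add hU hV w1
    have s4 := s3.add hU hV w2
    rw [← doubleSum_const_mul, ← doubleSum_const_mul, ← doubleSum_add hU w11 w12 hu hv,
      ← doubleSum_add hU s1 w22 hu hv, ← doubleSum_add hU s2 w1 hu hv,
      ← doubleSum_add hU s3 w2 hu hv, ← doubleSum_add hU s4 w0 hu hv, hE]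
    congr 1
    funext p
    simp only [euler₁, euler₂]
    ring
  have huv : (1 - x) * (1 - y) + x * y = 1 - u - v := by rw [hu_def, hv_def]; ring
  rw [e11, e22] at hE'
  linear_combination E * huv + hE' + e12 + e21
    + (doubleSum (partial₂ (euler₁ appellCoeff)) u v) * hv_def
    + (doubleSum (partial₁ (euler₂ appellCoeff)) u v) * hu_def

lemma appellF_zero_left (y : ℝ) : appellF 0 y = ellA y := by
  rw [appellF, ellA, powerSum, doubleSum]
  have hinj : Function.Injective fun j : ℕ => ((0, j) : ℕ × ℕ) := by
    intro i j h
    simpa using h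
  rw [← hinj.tsum_eq]
  · simp [appellCoeff]
  · rintro ⟨_ | i, j⟩ h
    · exact ⟨j, rfl⟩
    · simp at h

lemma appellF_eq_mul {x y : ℝ} (hx : -(127 / 1000) < x) (hx0 : x ≤ 0) (hy : |y| < 51 / 200) :
    appellF x y = ellA x * ellA y := by
  have hz : ∀ z ∈ Set.Icc x 0, |z| < 127 / 1000 := fun z hz =>
    abs_lt.2 ⟨by linarith [hz.1], by linarith [hz.2]⟩
  have hz1 : ∀ z ∈ Set.Icc x 0, |z| < 1 := fun z h => by linarith [hz z h]
  have hF : ∀ z ∈ Set.Icc x 0, HasDerivAt (fun z => appellF z y) _ z := fun z h =>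
    hasDerivAt_doubleSum_fst weightedSummable_appellCoeff_box (hz z h) hy
  have hW : ∀ z ∈ Set.Icc x 0, HasDerivAt
      (fun z => appellM z y * ellA z - appellF z y * (z * (1 - z) * ellA' z)) 0 z := by
    intro z h
    refine (((hasDerivAt_appellM (hz z h) hy).fun_mul (hasDerivAt_ellA (hz1 z h))).fun_sub
      ((hF z h).fun_mul (hasDerivAt_ellA_weighted (hz1 z h)))).congr_deriv ?_
    rw [appellM_eq]
    ring
  have hconst := constant_of_has_deriv_right_zero
    (fun z h => (hW z h).continuousAt.continuousWithinAt)
    (fun z h => (hW z (Set.Ico_subset_Icc_self h)).hasDerivWithinAt)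
  have hzero : ∀ z ∈ Set.Icc x 0,
      appellM z y * ellA z - appellF z y * (z * (1 - z) * ellA' z) = 0 := by
    intro z h
    rw [hconst z h, ← hconst 0 ⟨hx0, le_rfl⟩]
    simp [appellM_eq]
  have hA : ∀ z ∈ Set.Icc x 0, ellA z ≠ 0 := fun z h => (ellA_pos (by linarith [hz z h])).ne'
  have hQ : ∀ z ∈ Set.Icc x 0, HasDerivAt (fun z => appellF z y / ellA z) _ z := fun z h =>
    (hF z h).fun_div (hasDerivAt_ellA (hz1 z h)) (hA z h)
  have hquot := constant_of_has_deriv_right_zero (f := fun z => appellF z y / ellA z)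
    (a := x) (b := 0) (fun z h => (hQ z h).continuousAt.continuousWithinAt) (fun z h => by
      have h' := Set.Ico_subset_Icc_self h
      refine ((hQ z h').congr_deriv ?_).hasDerivWithinAt
      have h0 := hzero z h'
      rw [appellM_eq] at h0
      have hne : z * (1 - z) ≠ 0 := mul_ne_zero h.2.ne (by linarith [h.2])
      rw [div_eq_zero_iff]
      left
      refine mul_left_cancel₀ hne ?_
      linear_combination h0)
  have h := hquot 0 ⟨hx0, le_rfl⟩
  simp only [appellF_zero_left, ellA_zero, div_one] at h
  rw [h, mul_div_cancel₀ _ (hA x ⟨le_rfl, hx0⟩)]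

lemma appellM_eq_mul {x y : ℝ} (hx : -(127 / 1000) < x) (hx0 : x < 0) (hy : |y| < 51 / 200) :
    appellM x y = x * (1 - x) * ellA' x * ellA y := by
  have hx' : |x| < 127 / 1000 := abs_lt.2 ⟨hx, by linarith⟩
  have h1 := hasDerivAt_doubleSum_fst weightedSummable_appellCoeff_box hx' hy
  have h2 := (hasDerivAt_ellA (show |x| < 1 by linarith)).mul_const (ellA y)
  have h3 : (fun x => doubleSum appellCoeff (x * (1 - y)) (y * (1 - x)))
      =ᶠ[nhds x] fun x => ellA x * ellA y := by
    filter_upwards [Ioo_mem_nhds hx hx0] with z hz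
    exact appellF_eq_mul hz.1 hz.2.le hy
  rw [appellM_eq, h1.unique (h2.congr_of_eventuallyEq h3)]
  ring

lemma appell_snd_eq_mul {x y : ℝ} (hx : -(127 / 1000) < x) (hx0 : x < 0) (hy : |y| < 51 / 200) :
    (1 - y) * doubleSum (euler₂ appellCoeff) (x * (1 - y)) (y * (1 - x))
      - y * doubleSum (euler₁ appellCoeff) (x * (1 - y)) (y * (1 - x))
      = y * (1 - y) * ellA' y * ellA x := by
  have hx' : |x| < 127 / 1000 := abs_lt.2 ⟨hx, by linarith⟩
  have h1 := hasDerivAt_doubleSum_snd weightedSummable_appellCoeff_box hx' hy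
  have h2 := (hasDerivAt_ellA (show |y| < 1 by linarith)).const_mul (ellA x)
  have h3 : (fun y => doubleSum appellCoeff (x * (1 - y)) (y * (1 - x)))
      =ᶠ[nhds y] fun y => ellA x * ellA y := by
    have hmem : {z : ℝ | |z| < 51 / 200} ∈ nhds y :=
      (isOpen_lt continuous_abs continuous_const).mem_nhds hy
    filter_upwards [hmem] with z hz
    exact appellF_eq_mul hx hx0.le hz
  have h4 := h1.unique (h2.congr_of_eventuallyEq h3)
  rw [doubleSum_euler₁, doubleSum_euler₂]
  linear_combination y * (1 - y) * h4

/-- The argument `-(1 - r)² / (4 r)`, for which `ellA` equals `√r` times `ellA (1 - r²)`. -/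
noncomputable def landenArg (r : ℝ) : ℝ := -(1 - r) ^ 2 / (4 * r)

/-- The weighted Wronskian of `√r * ellA (r ^ 2)` and `ellA (landenArg r)`. -/
noncomputable def landenWronskian (r : ℝ) : ℝ :=
  √r * (-4 * ellA (r ^ 2) * (landenArg r * (1 - landenArg r) * ellA' (landenArg r))
    - 2 * (r ^ 2 * (1 - r ^ 2) * ellA' (r ^ 2)) * ellA (landenArg r) / r
    - (1 - r ^ 2) * ellA (r ^ 2) * ellA (landenArg r) / (2 * r))

lemma hasDerivAt_landenArg {r : ℝ} (hr : r ≠ 0) :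
    HasDerivAt landenArg ((1 - r ^ 2) / (4 * r ^ 2)) r := by
  have h := ((((hasDerivAt_id r).const_sub 1).fun_pow 2).fun_neg).fun_div
    ((hasDerivAt_id r).const_mul 4) (by simpa using hr)
  refine h.congr_deriv ?_
  simp only [id]
  field_simp
  ring

lemma abs_landenArg_lt_one {r : ℝ} (h0 : 1 / 2 ≤ r) (h1 : r ≤ 1) : |landenArg r| < 1 := by
  rw [landenArg, abs_div, abs_neg, abs_of_nonneg (sq_nonneg _), abs_of_pos (by linarith),
    div_lt_one (by linarith)]
  nlinarith

lemma hasDerivAt_landenWronskian {r : ℝ} (h0 : 1 / 2 ≤ r) (h1 : r < 1) :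
    HasDerivAt landenWronskian 0 r := by
  have hr : r ≠ 0 := by linarith
  have hrpos : 0 < r := by linarith
  have ha := abs_landenArg_lt_one h0 h1.le
  have hb : |r ^ 2| < 1 := by rw [abs_of_nonneg (sq_nonneg r)]; nlinarith
  have da := hasDerivAt_landenArg hr
  have db : HasDerivAt (fun r : ℝ => r ^ 2) (2 * r) r := by simpa using hasDerivAt_pow 2 r
  have dAa := (hasDerivAt_ellA ha).comp r da
  have dAb := HasDerivAt.comp (h := fun r : ℝ => r ^ 2) r (hasDerivAt_ellA hb) db
  have dNa := (hasDerivAt_ellA_weighted ha).comp r da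
  have dNb := HasDerivAt.comp (h := fun r : ℝ => r ^ 2) r (hasDerivAt_ellA_weighted hb) db
  have h := (Real.hasDerivAt_sqrt hr).fun_mul ((((dAb.const_mul (-4)).fun_mul dNa).fun_sub
    (((dNb.const_mul 2).fun_mul dAa).fun_div (hasDerivAt_id r) hr)).fun_sub
    ((((db.const_sub 1).fun_mul dAb).fun_mul dAa).fun_div ((hasDerivAt_id r).const_mul 2)
      (by simpa using hr)))
  refine h.congr_deriv ?_
  simp only [Function.comp, id]
  have hsq : 1 / (2 * √r) = √r / (2 * r) := by
    rw [div_eq_div_iff (by positivity) (by positivity)]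
    nlinarith [Real.mul_self_sqrt hrpos.le]
  rw [hsq]
  generalize ellA (r ^ 2) = B
  generalize ellA' (r ^ 2) = B'
  generalize ellA (landenArg r) = A
  generalize ellA' (landenArg r) = A'
  rw [landenArg]
  field_simp
  ring

lemma tendsto_landenWronskian :
    Tendsto landenWronskian (nhdsWithin 1 (Set.Iio 1)) (nhds (-2 / π)) := by
  have hid : Tendsto (fun r : ℝ => r) (nhdsWithin 1 (Set.Iio 1)) (nhds 1) :=
    tendsto_nhdsWithin_of_tendsto_nhds tendsto_id
  have hmem : Set.Ioo (1 / 2 : ℝ) 1 ∈ nhdsWithin (1 : ℝ) (Set.Iio 1) :=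
    Ioo_mem_nhdsLT (by norm_num)
  have hsq : Tendsto (fun r : ℝ => r ^ 2) (nhdsWithin 1 (Set.Iio 1))
      (nhdsWithin 1 (Set.Iio 1)) := by
    refine tendsto_nhdsWithin_of_tendsto_nhds_of_eventually_within _ (by simpa using hid.pow 2) ?_
    filter_upwards [hmem] with r hr
    simp only [Set.mem_Iio]
    nlinarith [hr.1, hr.2]
  have hP := tendsto_one_sub_mul_ellA.comp hsq
  have hQ := tendsto_one_sub_mul_ellA'.comp hsq
  have harg : Tendsto landenArg (nhdsWithin 1 (Set.Iio 1)) (nhds 0) := by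
    have h := (hasDerivAt_landenArg one_ne_zero).continuousAt.tendsto
    simp only [landenArg, sub_self] at h
    refine tendsto_nhdsWithin_of_tendsto_nhds ?_
    simpa using h
  have hA : Tendsto (fun r => ellA (landenArg r)) (nhdsWithin 1 (Set.Iio 1)) (nhds 1) := by
    have h := (hasDerivAt_ellA (x := 0) (by simp)).continuousAt.tendsto
    rw [ellA_zero] at h
    exact h.comp harg
  have hA' : Tendsto (fun r => ellA' (landenArg r)) (nhdsWithin 1 (Set.Iio 1))
      (nhds (ellA' 0)) :=
    (hasDerivAt_ellA' (x := 0) (by simp)).continuousAt.tendsto.comp harg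
  have hsqrt : Tendsto (fun r : ℝ => √r) (nhdsWithin 1 (Set.Iio 1)) (nhds 1) := by
    simpa using hid.sqrt
  have h1 := ((hP.mul (((hid.pow 2).const_sub 1).div ((hid.pow 2).const_mul 4)
    (by norm_num))).mul hA')
  have h2 := ((hid.const_mul 2).mul hQ).mul hA
  have h3 := (hP.mul hA).div (hid.const_mul 2) (by norm_num)
  have h := hsqrt.mul ((h1.sub h2).sub h3)
  have hl : (1 : ℝ) * (0 * ((1 - 1 ^ 2) / (4 * 1 ^ 2)) * ellA' 0 - 2 * 1 * (1 / π) * 1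
      - 0 * 1 / (2 * 1)) = -2 / π := by ring
  rw [hl] at h
  refine h.congr' ?_
  filter_upwards [hmem] with r hr
  have hr0 : r ≠ 0 := by linarith [hr.1]
  simp only [landenWronskian, Function.comp, Pi.div_apply]
  generalize ellA (r ^ 2) = B
  generalize ellA' (r ^ 2) = B'
  generalize ellA (landenArg r) = A
  generalize ellA' (landenArg r) = A'
  rw [landenArg]
  field_simp
  ring

lemma landenWronskian_half : landenWronskian (1 / 2) = -2 / π := by
  refine tendsto_nhds_unique (f := landenWronskian) (l := nhdsWithin 1 (Set.Iio 1))
    (tendsto_const_nhds.congr' ?_) tendsto_landenWronskian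
  have hmem : Set.Ioo (1 / 2 : ℝ) 1 ∈ nhdsWithin (1 : ℝ) (Set.Iio 1) :=
    Ioo_mem_nhdsLT (by norm_num)
  filter_upwards [hmem] with r hr
  have hd : ∀ z ∈ Set.Icc (1 / 2) r, HasDerivAt landenWronskian 0 z := fun z hz =>
    hasDerivAt_landenWronskian hz.1 (hz.2.trans_lt hr.2)
  exact (constant_of_has_deriv_right_zero
    (fun z hz => (hd z hz).continuousAt.continuousWithinAt)
    (fun z hz => (hd z (Set.Ico_subset_Icc_self hz)).hasDerivWithinAt) r ⟨hr.1.le, le_rfl⟩).symm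

lemma appell_value :
    700 * (doubleSum (euler₁ appellCoeff) (-(3 / 32)) (9 / 32)
        + doubleSum (euler₂ appellCoeff) (-(3 / 32)) (9 / 32))
      + 150 * doubleSum appellCoeff (-(3 / 32)) (9 / 32) = 400 * √2 / π := by
  have hy : |(1 / 4 : ℝ)| < 51 / 200 := by rw [abs_of_pos] <;> norm_num
  have hF := appellF_eq_mul (x := -(1 / 8)) (y := 1 / 4) (by norm_num) (by norm_num) hy
  have hM := appellM_eq_mul (x := -(1 / 8)) (y := 1 / 4) (by norm_num) (by norm_num) hy
  have hN := appell_snd_eq_mul (x := -(1 / 8)) (y := 1 / 4) (by norm_num) (by norm_num) hy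
  rw [appellF] at hF
  rw [appellM] at hM
  have hu : -(1 / 8) * (1 - 1 / 4) = (-(3 / 32) : ℝ) := by norm_num
  have hv : 1 / 4 * (1 - -(1 / 8)) = (9 / 32 : ℝ) := by norm_num
  rw [hu, hv] at hF hM hN
  have hW := landenWronskian_half
  have ha : landenArg (1 / 2) = -(1 / 8) := by norm_num [landenArg]
  rw [landenWronskian, ha, show ((1 : ℝ) / 2) ^ 2 = 1 / 4 by norm_num] at hW
  have hs : √(1 / 2 : ℝ) * √2 = 1 := by
    rw [← Real.sqrt_mul (by norm_num)]
    norm_num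
  have h2 : √(2 : ℝ) * √2 = 2 := Real.mul_self_sqrt (by norm_num)
  have hK : ∀ K : ℝ, √(1 / 2) * K = -2 / π → K = -2 / π * √2 := by
    intro K hK
    rw [← hK]
    linear_combination -K * hs
  have := hK _ hW
  linear_combination -200 * this + 150 * hF + 800 * hM + 800 * hN

lemma weightedSummable_linear_mul {U V : ℝ} (hU : 0 < U) (hV : 0 < V) {a : ℕ × ℕ → ℝ}
    (ha : WeightedSummable U V a) (α β γ : ℝ) :
    WeightedSummable U V fun p => (α + β * p.1 + γ * p.2) * a p := by
  have h := ((ha.const_mul hU hV α).add hU hV ((ha.euler₁ hU hV).const_mul hU hV β)).add hU hV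
    ((ha.euler₂ hU hV).const_mul hU hV γ)
  convert h using 2
  simp only [euler₁, euler₂]
  ring

/-- The coefficient polynomial of the series after expanding the Legendre polynomials, as a
function of the two summation indices. -/
def weightPoly (i j : ℝ) : ℝ :=
  14 * (196 * (i + j) ^ 2 + 196 * (i + j) - 3) * (j - i)
    - (1372 * (i + j) ^ 3 + 3024 * (i + j) ^ 2 + 1631 * (i + j) + 375)

lemma hasSum_weightPoly :
    HasSum (fun p : ℕ × ℕ =>
        weightPoly p.1 p.2 * appellCoeff p * (-(3 / 32)) ^ p.1 * (9 / 32) ^ p.2)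
      (400 * √2 / π) := by
  have hU : (0 : ℝ) < 4 / 25 := by norm_num
  have hV : (0 : ℝ) < 121 / 400 := by norm_num
  have H : ∀ {a : ℕ × ℕ → ℝ}, WeightedSummable (4 / 25) (121 / 400) a →
      HasSum (fun p : ℕ × ℕ => a p * (-(3 / 32)) ^ p.1 * (9 / 32) ^ p.2)
        (doubleSum a (-(3 / 32)) (9 / 32)) := fun ha =>
    (ha.summable hU (by rw [abs_le]; norm_num) (by rw [abs_le]; norm_num)).hasSum
  have hc := weightedSummable_appellCoeff_box
  have hc₁ := hc.euler₁ hU hV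
  have hc₂ := hc.euler₂ hU hV
  have hw₁ := weightedSummable_linear_mul hU hV hc₁ (-2912) (-3360) (-4256)
  have hw₂ := weightedSummable_linear_mul hU hV hc₂ 2912 1568 2464
  have key := (((((H hc₁).add (H hc₂)).mul_left 700).add ((H hc).mul_left 150)).add
    ((H (hw₁.euler₁ hU hV)).add ((H (hw₁.partial₁ hU hV)).mul_left (3 / 32)))).add
    ((H (hw₂.euler₂ hU hV)).sub ((H (hw₂.partial₂ hU hV)).mul_left (9 / 32)))
  rw [appell_value, doubleSum_euler₁, doubleSum_euler₂, neg_mul, neg_add_cancel, sub_self,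
    add_zero, add_zero] at key
  refine (congrArg (HasSum · (400 * √2 / π)) (funext fun ⟨i, j⟩ => ?_)).mpr key
  have h1 := appellCoeff_succ_fst i j
  have h2 := appellCoeff_succ_snd i j
  simp only [euler₁, euler₂, partial₁, partial₂, weightPoly]
  push_cast
  linear_combination (-(3 / 32)) ^ i * (9 / 32) ^ j *
    (-(3 / 32) * (-2912 + -3360 * ((i : ℝ) + 1) + -4256 * j) * h1
      + 9 / 32 * (2912 + 1568 * (i : ℝ) + 2464 * (j + 1)) * h2)

lemma hasSum_antidiagonal {f : ℕ × ℕ → ℝ} {s : ℝ} (h : HasSum f s) :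
    HasSum (fun n => ∑ p ∈ Finset.HasAntidiagonal.antidiagonal n, f p) s := by
  have h' := (Finset.HasAntidiagonal.sigmaAntidiagonalEquivProd (A := ℕ)).hasSum_iff.2 h
  refine h'.sigma fun n => ?_
  rw [← Finset.sum_coe_sort]
  exact hasSum_fintype _

lemma sum_antidiagonal_legendreP (n : ℕ) :
    ∑ p ∈ Finset.HasAntidiagonal.antidiagonal n,
        ((p.1 + p.2).choose p.1 : ℝ) ^ 2 * (-(3 / 32)) ^ p.1 * (9 / 32) ^ p.2
      = (3 / 8) ^ n * legendreP n (1 / 2) := by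
  rw [← Finset.Nat.sum_antidiagonal_swap, Finset.Nat.sum_antidiagonal_eq_sum_range_succ_mk,
    legendreP, ← mul_assoc, Finset.mul_sum]
  refine Finset.sum_congr rfl fun j hj => ?_
  obtain ⟨i, rfl⟩ := Nat.exists_eq_add_of_le (Nat.lt_succ_iff.1 (Finset.mem_range.1 hj))
  simp only [Prod.swap, Nat.add_sub_cancel_left]
  have hch : (i + j).choose i = (j + i).choose j := by
    rw [add_comm, Nat.choose_symm_add]
  rw [hch, show (-(3 / 32) : ℝ) = (3 / 8 * 2⁻¹) * (1 / 2 - 1) by norm_num,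
    show (9 / 32 : ℝ) = (3 / 8 * 2⁻¹) * (1 / 2 + 1) by norm_num]
  simp only [mul_pow, pow_add]
  ring

lemma sum_antidiagonal_legendreP_pred (n : ℕ) :
    ∑ p ∈ Finset.HasAntidiagonal.antidiagonal n,
        ((p.2 : ℝ) - p.1) * (((p.1 + p.2).choose p.1 : ℝ) ^ 2 * (-(3 / 32)) ^ p.1 * (9 / 32) ^ p.2)
      = (3 / 8) ^ n * (n * legendreP (n - 1) (1 / 2)) := by
  rcases n with _ | m
  · simp
  set u : ℝ := -(3 / 32)
  set v : ℝ := 9 / 32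
  have e1 : ∑ p ∈ Finset.HasAntidiagonal.antidiagonal (m + 1),
      ((m : ℝ) + 1) * (m.choose p.1 : ℝ) ^ 2 * u ^ p.1 * v ^ p.2
      = v * ((m + 1) * ((3 / 8) ^ m * legendreP m (1 / 2))) := by
    rw [Finset.Nat.sum_antidiagonal_succ', ← sum_antidiagonal_legendreP, Finset.mul_sum,
      Finset.mul_sum]
    simp only [Nat.choose_succ_self, Nat.cast_zero, ne_eq, OfNat.ofNat_ne_zero, not_false_eq_true,
      zero_pow, mul_zero, zero_mul, zero_add]
    refine Finset.sum_congr rfl fun p hp => ?_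
    rw [Finset.HasAntidiagonal.mem_antidiagonal] at hp
    rw [hp]
    ring
  have e2 : ∑ p ∈ Finset.HasAntidiagonal.antidiagonal (m + 1),
      ((m : ℝ) + 1) * (m.choose p.2 : ℝ) ^ 2 * u ^ p.1 * v ^ p.2
      = u * ((m + 1) * ((3 / 8) ^ m * legendreP m (1 / 2))) := by
    rw [Finset.Nat.sum_antidiagonal_succ, ← sum_antidiagonal_legendreP, Finset.mul_sum,
      Finset.mul_sum]
    simp only [Nat.choose_succ_self, Nat.cast_zero, ne_eq, OfNat.ofNat_ne_zero, not_false_eq_true,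
      zero_pow, mul_zero, zero_mul, zero_add]
    refine Finset.sum_congr rfl fun p hp => ?_
    rw [Finset.HasAntidiagonal.mem_antidiagonal] at hp
    rw [← hp, ← Nat.choose_symm_add]
    ring
  have e3 : (3 / 8 : ℝ) ^ (m + 1) * ((m + 1 : ℕ) * legendreP (m + 1 - 1) (1 / 2))
      = v * ((m + 1) * ((3 / 8) ^ m * legendreP m (1 / 2)))
        - u * ((m + 1) * ((3 / 8) ^ m * legendreP m (1 / 2))) := by
    simp only [u, v, Nat.add_sub_cancel]
    push_cast
    ring
  rw [e3, ← e1, ← e2, ← Finset.sum_sub_distrib]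
  refine Finset.sum_congr rfl fun p hp => ?_
  obtain ⟨i, j⟩ := p
  rw [Finset.HasAntidiagonal.mem_antidiagonal] at hp
  simp only at hp ⊢
  have hr : (i : ℝ) + j = m + 1 := by exact_mod_cast hp
  have h1 : (m.choose i : ℝ) * (m + 1) = (m + 1).choose i * j := by
    have := Nat.choose_mul_succ_eq m i
    rw [show m + 1 - i = j by omega] at this
    exact_mod_cast this
  have h2 : (m.choose j : ℝ) * (m + 1) = (m + 1).choose i * i := by
    have := Nat.choose_mul_succ_eq m j
    rw [show m + 1 - j = i by omega, ← Nat.choose_symm_of_eq_add hp.symm] at this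
    exact_mod_cast this
  have hm : (m : ℝ) + 1 ≠ 0 := by positivity
  rw [hp]
  apply mul_left_cancel₀ hm
  linear_combination u ^ i * v ^ j * (((m + 1).choose i : ℝ) ^ 2 * (i - j) * hr
    - ((m.choose i : ℝ) * (m + 1) + (m + 1).choose i * j) * h1
    + ((m.choose j : ℝ) * (m + 1) + (m + 1).choose i * i) * h2)

lemma sum_antidiagonal_weightPoly (n : ℕ) :
    ∑ p ∈ Finset.HasAntidiagonal.antidiagonal n,
        weightPoly p.1 p.2 * appellCoeff p * (-(3 / 32)) ^ p.1 * (9 / 32) ^ p.2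
      = ((2 * n).choose n : ℝ) ^ 2 * (3 / 128) ^ n *
        (14 * (n : ℝ) * (196 * (n : ℝ) ^ 2 + 196 * (n : ℝ) - 3) * legendreP (n - 1) (1 / 2) -
         (1372 * (n : ℝ) ^ 3 + 3024 * (n : ℝ) ^ 2 + 1631 * (n : ℝ) + 375)
           * legendreP n (1 / 2)) := by
  have hcoeff : ((2 * n).choose n : ℝ) ^ 2 * (3 / 128) ^ n = ellipticCoeff n * (3 / 8) ^ n := by
    rw [ellipticCoeff, Nat.centralBinom_eq_two_mul_choose, div_mul_eq_mul_div, mul_div_assoc,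
      ← div_pow]
    norm_num
  calc _ = ∑ p ∈ Finset.HasAntidiagonal.antidiagonal n, ellipticCoeff n *
        (14 * (196 * (n : ℝ) ^ 2 + 196 * (n : ℝ) - 3) * (((p.2 : ℝ) - p.1) *
            (((p.1 + p.2).choose p.1 : ℝ) ^ 2 * (-(3 / 32)) ^ p.1 * (9 / 32) ^ p.2))
          - (1372 * (n : ℝ) ^ 3 + 3024 * (n : ℝ) ^ 2 + 1631 * (n : ℝ) + 375) *
            (((p.1 + p.2).choose p.1 : ℝ) ^ 2 * (-(3 / 32)) ^ p.1 * (9 / 32) ^ p.2)) := by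
        refine Finset.sum_congr rfl fun p hp => ?_
        rw [Finset.HasAntidiagonal.mem_antidiagonal] at hp
        subst hp
        simp only [weightPoly, appellCoeff]
        push_cast
        ring
    _ = _ := by
        rw [← Finset.mul_sum, Finset.sum_sub_distrib, ← Finset.mul_sum, ← Finset.mul_sum,
          sum_antidiagonal_legendreP, sum_antidiagonal_legendreP_pred, hcoeff]
        ring

theorem stmt8 :
    Tendsto (fun N => ∑ n ∈ Finset.range N,
      ((2 * n).choose n : ℝ) ^ 2 * (3 / 128) ^ n *
        (14 * (n : ℝ) * (196 * (n : ℝ) ^ 2 + 196 * (n : ℝ) - 3) * legendreP (n - 1) (1 / 2) -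
         (1372 * (n : ℝ) ^ 3 + 3024 * (n : ℝ) ^ 2 + 1631 * (n : ℝ) + 375) * legendreP n (1 / 2)))
      atTop (nhds (400 * Real.sqrt 2 / π)) := by
  simpa only [sum_antidiagonal_weightPoly] using
    (hasSum_antidiagonal hasSum_weightPoly).tendsto_sum_nat
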